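/- arXiv:2404.04024 — 4 statements merged into one kernel-verified Lean document; each statement's English description precedes it below -/
import Mathlib

section
/- Let R and R' be commutative rings, S ⊆ R a multiplicatively closed set with canonical localization map ι : R → S⁻¹R, and let φ* : R → R' and ψ* : R' → S⁻¹R be ring homomorphisms such that ψ* ∘ φ* = ι. Let I' ⊆ R' be a prime ideal generated by finitely many elements f'₁, …, f'ₖ, and suppose that for each i there exist gᵢ ∈ R and hᵢ ∈ S with ψ*(f'ᵢ) = ι(gᵢ)·ι(hᵢ)⁻¹. Set I = (φ*)⁻¹(I') and let J = ⟨g₁, …, gₖ⟩ be the ideal of R generated by the gᵢ. If J ⊆ I and I ∩ S = ∅, then I = J : S. -/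
/-- Saturation Lemma.
Let `R, R'` be commutative rings, `S ⊆ R` a multiplicatively closed set with canonical
localization map `ι : R → S⁻¹R`, and `φ : R → R'`, `ψ : R' → S⁻¹R` ring homomorphisms
with `ψ ∘ φ = ι`.  Let `I'` be a prime ideal of `R'` generated by `f'₁, …, f'ₖ`, and
suppose `ψ (f'ᵢ) = ι gᵢ · (ι hᵢ)⁻¹` with `hᵢ ∈ S` (expressed as `ψ (f'ᵢ) · ι hᵢ = ι gᵢ`,
which is equivalent since `ι hᵢ` is a unit of `S⁻¹R`).  Set `I = φ⁻¹(I')` and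
`J = ⟨g₁, …, gₖ⟩`.  If `J ⊆ I` and `I ∩ S = ∅`, then `I = J : S`. -/
theorem saturation_lemma
    (R R' : Type*) [CommRing R] [CommRing R']
    (S : Submonoid R)
    (φ : R →+* R') (ψ : R' →+* Localization S)
    (hcomp : ψ.comp φ = (algebraMap R (Localization S) : R →+* Localization S))
    (k : ℕ) (f' : Fin k → R')
    (I' : Ideal R') (hI'span : I' = Ideal.span (Set.range f')) (hI'prime : I'.IsPrime)
    (g : Fin k → R) (h : Fin k → S)
    (hfrac : ∀ i : Fin k,
      ψ (f' i) * algebraMap R (Localization S) ((h i : R)) =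
        algebraMap R (Localization S) (g i))
    (I : Ideal R) (hI : I = I'.comap φ)
    (J : Ideal R) (hJ : J = Ideal.span (Set.range g))
    (hJI : J ≤ I) (hIS : ∀ s ∈ S, s ∉ I) :
    ∀ f : R, f ∈ I ↔ ∃ s ∈ S, f * s ∈ J := by
  subst hI hJ
  have hmap : I'.map ψ ≤ (Ideal.span (Set.range g)).map (algebraMap R (Localization S)) := by
    rw [hI'span, Ideal.map_span, Ideal.span_le]
    rintro _ ⟨_, ⟨i, rfl⟩, rfl⟩
    rw [SetLike.mem_coe,
      ← Ideal.mul_unit_mem_iff_mem _ (IsLocalization.map_units (Localization S) (h i)), hfrac i]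
    exact Ideal.mem_map_of_mem _ (Ideal.subset_span ⟨i, rfl⟩)
  intro f
  constructor
  · intro hf
    have hιf : algebraMap R (Localization S) f ∈
        (Ideal.span (Set.range g)).map (algebraMap R (Localization S)) := by
      rw [← RingHom.congr_fun hcomp f]
      exact hmap (Ideal.mem_map_of_mem ψ hf)
    obtain ⟨s, hs, hsf⟩ := (IsLocalization.algebraMap_mem_map_algebraMap_iff S _ _ _).1 hιf
    exact ⟨s, hs, mul_comm s f ▸ hsf⟩
  · rintro ⟨s, hs, hfs⟩
    exact ((hI'prime.comap φ).mem_or_mem (hJI hfs)).resolve_right (hIS s hs)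
end

section
/- Let G = (V,E) be a DAG, Ω = diag(ω_i) with all ω_i > 0, Λ ∈ ℝ^E, and Σ = φ_G(Ω,Λ). Then for every vertex i ∈ V, ω_i · |Σ_{pa_G(i)}| = |Σ_{pa_G(i)∪{i}}|; equivalently, ω_i = ω_{i|pa_G(i)}(Σ). -/
open Matrix

/-- Principal minor `|Σ_A|`: determinant of the submatrix with rows and columns `A`. -/
noncomputable def pminor {p : ℕ} {R : Type*} [CommRing R] (M : Matrix (Fin p) (Fin p) R)
    (A : Finset (Fin p)) : R :=
  (M.submatrix (fun a : {x // x ∈ A} => a.1) (fun a : {x // x ∈ A} => a.1)).det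

/-- Almost-principal minor `|Σ_{ij|K}| = |Σ_{{i}∪K, {j}∪K}|`: determinant of the submatrix
with rows `{i} ∪ K` and columns `{j} ∪ K`, where `i` is matched with `j` and the elements
of `K` are matched with themselves. -/
noncomputable def cminor {p : ℕ} {R : Type*} [CommRing R] (M : Matrix (Fin p) (Fin p) R)
    (i j : Fin p) (K : Finset (Fin p)) : R :=
  (M.submatrix (Sum.elim (fun _ : Unit => i) (fun k : {x // x ∈ K} => k.1))
               (Sum.elim (fun _ : Unit => j) (fun k : {x // x ∈ K} => k.1))).det

/-- The parametrization `φ_G(Ω,Λ) = (1-Λ)^{-T} Ω (1-Λ)⁻¹` of a Gaussian DAG model. -/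
noncomputable def phiG {p : ℕ} (W L : Matrix (Fin p) (Fin p) ℝ) : Matrix (Fin p) (Fin p) ℝ :=
  ((1 - L)⁻¹)ᵀ * W * (1 - L)⁻¹

/-- The parents `pa_G(j) = {k : (k,j) ∈ E}` of a vertex `j` in the DAG with edge set `E`. -/
def parents {p : ℕ} (E : Finset (Fin p × Fin p)) (j : Fin p) : Finset (Fin p) :=
  Finset.univ.filter (fun k => (k, j) ∈ E)

/-- A directed graph with edge set `E` is acyclic iff no vertex lies on a directed cycle. -/
def IsAcyclic {p : ℕ} (E : Finset (Fin p × Fin p)) : Prop :=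
  ∀ i : Fin p, ¬ Relation.TransGen (fun a b => (a, b) ∈ E) i i

/-- `j` lies in `de̅_G(i) = {i} ∪ de_G(i)`, the closure of the descendants of `i`. -/
def InDescClosure {p : ℕ} (E : Finset (Fin p × Fin p)) (i j : Fin p) : Prop :=
  j = i ∨ Relation.TransGen (fun a b => (a, b) ∈ E) i j

/-- If column `i` of `M` is, on the rows `insert i A`, a combination of the columns in `A` plus
`w` times the `i`-th unit vector, then `|M_{A ∪ {i}}| = w |M_A|`. -/
theorem pminor_insert_of_column_eq {p : ℕ} {R : Type*} [CommRing R]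
    (M : Matrix (Fin p) (Fin p) R) {A : Finset (Fin p)} {i : Fin p} (hi : i ∉ A)
    (c : Fin p → R) (w : R)
    (hA : ∀ k ∈ A, M k i = ∑ l ∈ A, M k l * c l)
    (hw : M i i = ∑ l ∈ A, M i l * c l + w) :
    pminor M (insert i A) = w * pminor M A := by
  let f : {x // x ∈ A} → Fin p := Subtype.val
  let g : Unit → Fin p := fun _ => i
  let e : {x // x ∈ A} ⊕ Unit ≃ {x // x ∈ insert i A} :=
    ((Finset.subtypeInsertEquivOption hi).trans (Equiv.optionEquivSumPUnit _)).symm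
  have hfactor : (M.submatrix (fun a : {x // x ∈ insert i A} => a.1)
      (fun a : {x // x ∈ insert i A} => a.1)).submatrix e e =
      fromBlocks (M.submatrix f f) 0 (M.submatrix g f) (of fun _ _ => w) *
        fromBlocks 1 (of fun l _ => c l.1) 0 1 := by
    rw [fromBlocks_multiply]
    ext (a | a) (b | b)
    · simp [e, f, Finset.subtypeInsertEquivOption]
    · simp [e, f, Finset.subtypeInsertEquivOption, mul_apply, hA a.1 a.2]
      exact (Finset.sum_attach A fun l => M a.1 l * c l).symm
    · simp [e, f, g, Finset.subtypeInsertEquivOption]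
    · simp [e, f, g, Finset.subtypeInsertEquivOption, mul_apply, hw]
      exact (Finset.sum_attach A fun l => M i l * c l).symm
  unfold pminor
  rw [← det_submatrix_equiv_self e, hfactor, det_mul, det_fromBlocks_zero₁₂,
    det_fromBlocks_zero₂₁]
  simp [f, mul_comm]

/-- The vertices of a DAG can be ranked so that the rank increases along every edge. -/
theorem IsAcyclic.exists_rank {p : ℕ} {E : Finset (Fin p × Fin p)} (hE : IsAcyclic E) :
    ∃ r : Fin p → ℕ, ∀ a b, (a, b) ∈ E → r a < r b := by
  classical
  refine ⟨fun v => (Finset.univ.filter fun u =>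
    Relation.TransGen (fun a b => (a, b) ∈ E) u v).card, fun a b hab => ?_⟩
  refine Finset.card_lt_card (Finset.ssubset_iff_of_subset ?_ |>.2 ⟨a, ?_, ?_⟩)
  · intro u hu
    simp only [Finset.mem_filter, Finset.mem_univ, true_and] at hu ⊢
    exact hu.tail hab
  · simpa using Relation.TransGen.single hab
  · simpa using hE a

/-- A principal minor of a positive definite matrix is positive. -/
theorem pminor_pos {p : ℕ} {M : Matrix (Fin p) (Fin p) ℝ} (hM : M.PosDef)
    (A : Finset (Fin p)) : 0 < pminor M A :=
  (hM.submatrix Subtype.val_injective).det_pos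

section Rank

variable {p : ℕ} {L : Matrix (Fin p) (Fin p) ℝ} {r : Fin p → ℕ}

theorem blockTriangular_one_sub (hr : ∀ a b, L a b ≠ 0 → r a < r b) :
    (1 - L).BlockTriangular r := by
  refine blockTriangular_one.sub fun a b hab => ?_
  by_contra h
  exact hab.not_gt (hr a b h)

theorem det_one_sub_eq_one (hr : ∀ a b, L a b ≠ 0 → r a < r b) : (1 - L).det = 1 := by
  rw [(blockTriangular_one_sub hr).det]
  refine Finset.prod_eq_one fun k _ => ?_
  have hblock : (1 - L).toSquareBlock r k = 1 := by
    ext a b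
    have hL : L a.1 b.1 = 0 := by
      by_contra h
      exact (hr _ _ h).ne (a.2.trans b.2.symm)
    simp [toSquareBlock_def, one_apply, hL, Subtype.ext_iff]
  rw [hblock, det_one]

theorem inv_one_sub_apply_eq_zero (hr : ∀ a b, L a b ≠ 0 → r a < r b) {a b : Fin p}
    (hab : r b < r a) : (1 - L)⁻¹ a b = 0 := by
  have : Invertible (1 - L) :=
    invertibleOfIsUnitDet _ (by simp [det_one_sub_eq_one hr])
  exact blockTriangular_inv_of_blockTriangular (blockTriangular_one_sub hr) hab

theorem inv_one_sub_apply_self (hr : ∀ a b, L a b ≠ 0 → r a < r b) (a : Fin p) :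
    (1 - L)⁻¹ a a = 1 := by
  have hmul : (1 - L) * (1 - L)⁻¹ = 1 :=
    mul_nonsing_inv _ (by simp [det_one_sub_eq_one hr])
  have hentry := congrFun (congrFun hmul a) a
  have hzero : (L * (1 - L)⁻¹) a a = 0 := by
    rw [mul_apply]
    refine Finset.sum_eq_zero fun l _ => ?_
    by_cases h : L a l = 0
    · rw [h, zero_mul]
    · rw [inv_one_sub_apply_eq_zero hr (hr a l h), mul_zero]
  rwa [sub_mul, one_mul, Matrix.sub_apply, hzero, sub_zero, one_apply_eq] at hentry

/-- The structural equations of the covariance matrix: `Σ = Σ Λ + (1-Λ)^{-T} Ω`. -/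
theorem phiG_apply (hr : ∀ a b, L a b ≠ 0 → r a < r b) (ω : Fin p → ℝ) (k i : Fin p) :
    phiG (diagonal ω) L k i =
      ∑ l, phiG (diagonal ω) L k l * L l i + (1 - L)⁻¹ i k * ω i := by
  have hmul : phiG (diagonal ω) L * (1 - L) = ((1 - L)⁻¹)ᵀ * diagonal ω :=
    nonsing_inv_mul_cancel_right _ _ (by simp [det_one_sub_eq_one hr])
  have hentry := congrFun (congrFun hmul k) i
  rw [mul_sub, mul_one, Matrix.sub_apply, mul_diagonal, transpose_apply, mul_apply] at hentry
  linarith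

theorem posDef_phiG (hr : ∀ a b, L a b ≠ 0 → r a < r b) {ω : Fin p → ℝ}
    (hω : ∀ v, 0 < ω v) : (phiG (diagonal ω) L).PosDef := by
  have hunit : IsUnit (1 - L)⁻¹ := by
    rw [isUnit_nonsing_inv_iff, isUnit_iff_isUnit_det, det_one_sub_eq_one hr]
    exact isUnit_one
  have h := (PosDef.diagonal hω).conjTranspose_mul_mul_same (mulVec_injective_of_isUnit hunit)
  rwa [conjTranspose_eq_transpose_of_trivial] at h

end Rank

/-- Lemma on recovering error variances.
Let `G = (V,E)` be a DAG, `Ω = diag(ω)` with positive diagonal, `Λ ∈ ℝ^E`, and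
`Σ = φ_G(Ω,Λ)`.  Then for every vertex `i`,
`ω_i · |Σ_{pa(i)}| = |Σ_{pa(i) ∪ {i}}|`; equivalently `ω_i = ω_{i|pa(i)}(Σ)`. -/
theorem omega_recovery {p : ℕ} (E : Finset (Fin p × Fin p)) (hE : IsAcyclic E)
    (ω : Fin p → ℝ) (hω : ∀ v, 0 < ω v)
    (L : Matrix (Fin p) (Fin p) ℝ) (hL : ∀ a b, (a, b) ∉ E → L a b = 0)
    (S : Matrix (Fin p) (Fin p) ℝ) (hS : S = phiG (Matrix.diagonal ω) L)
    (i : Fin p) :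
    ω i * pminor S (parents E i) = pminor S (insert i (parents E i)) ∧
    ω i = pminor S (insert i (parents E i)) / pminor S (parents E i) := by
  subst hS
  obtain ⟨r, hrE⟩ := hE.exists_rank
  have hr : ∀ a b, L a b ≠ 0 → r a < r b := fun a b hab =>
    hrE a b (by_contra fun h => hab (hL a b h))
  have hmem : ∀ k, k ∈ parents E i ↔ (k, i) ∈ E := fun k => by simp [parents]
  have hi : i ∉ parents E i := fun h => (hrE i i ((hmem i).1 h)).ne rfl
  have hsum : ∀ k, ∑ l, phiG (diagonal ω) L k l * L l i =
      ∑ l ∈ parents E i, phiG (diagonal ω) L k l * L l i := fun k =>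
    (Finset.sum_subset (Finset.subset_univ _) fun l _ hl => by
      rw [hL l i fun h => hl ((hmem l).2 h), mul_zero]).symm
  have hminor := pminor_insert_of_column_eq (phiG (diagonal ω) L) hi (fun l => L l i) (ω i)
    (fun k hk => by
      rw [phiG_apply hr, inv_one_sub_apply_eq_zero hr (hrE k i ((hmem k).1 hk)), zero_mul,
        add_zero, hsum])
    (by rw [phiG_apply hr, inv_one_sub_apply_self hr, one_mul, hsum])
  refine ⟨hminor.symm, ?_⟩
  rw [hminor, mul_div_cancel_right₀ _ (pminor_pos (posDef_phiG hr hω) _).ne']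
end

section
/- Let G = (V,E) be a DAG and ij ∈ E an edge. If A ⊆ V is identifying for the edge ij, i.e., λ_{ij|A}(φ_G(Ω,Λ)) = λ_{ij} for every Ω = diag(ω_k) with all ω_k > 0 and every Λ ∈ ℝ^E, then i ∈ A and A ∩ de̅_G(j) = ∅ (i.e., i ∈ A ⊆ V ∖ de̅_G(j)). -/
open Matrix

open Relation

/-- Cramer's rule for almost-principal minors: if column `j` of `M`, restricted to the rows `A`,
is the combination of the columns in `A` with coefficients `c`, then `|M_{ij|A∖i}| = c i |M_A|`. -/
theorem cminor_erase_eq_mul_pminor {p : ℕ} {R : Type*} [CommRing R]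
    (M : Matrix (Fin p) (Fin p) R) {i : Fin p} (j : Fin p) {A : Finset (Fin p)} (hi : i ∈ A)
    (c : Fin p → R) (h : ∀ a ∈ A, M a j = ∑ b ∈ A, M a b * c b) :
    cminor M i j (A.erase i) = c i * pminor M A := by
  let N := M.submatrix (fun a : {x // x ∈ A} => a.1) (fun a : {x // x ∈ A} => a.1)
  let e : Unit ⊕ {x // x ∈ A.erase i} ≃ {x // x ∈ A} :=
    { toFun := Sum.elim (fun _ => ⟨i, hi⟩) (fun k => ⟨k.1, Finset.mem_of_mem_erase k.2⟩)
      invFun := fun a => if ha : a.1 = i then Sum.inl () else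
        Sum.inr ⟨a.1, Finset.mem_erase.2 ⟨ha, a.2⟩⟩
      left_inv := by
        rintro (x | x)
        · simp
        · simp [Finset.ne_of_mem_erase x.2]
      right_inv := by
        rintro ⟨a, ha⟩
        by_cases hai : a = i
        · simp [hai]
        · simp [hai] }
  have hcol : N *ᵥ (fun a => c a.1) = fun a => M a.1 j := by
    funext a
    rw [h a.1 a.2, ← Finset.sum_coe_sort A]
    rfl
  have key : cminor M i j (A.erase i) = (N.updateCol ⟨i, hi⟩ (fun a => M a.1 j)).det := by
    rw [← det_submatrix_equiv_self e]
    unfold cminor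
    congr 1
    ext r s
    rcases r with r | r <;> rcases s with s | s <;>
      simp [e, N, updateCol_apply]
    all_goals
      intro hs
      exact absurd hs (Finset.ne_of_mem_erase s.2)
  rw [key, ← cramer_apply, ← hcol, cramer_eq_adjugate_mulVec, mulVec_mulVec, adjugate_mul]
  simp [smul_mulVec, N, pminor, mul_comm]

/-- `X v` lists the coefficients of the `v`-th variable in terms of the noise variables. -/
def SolvesStructural {p : ℕ} (L X : Matrix (Fin p) (Fin p) ℝ) : Prop :=
  ∀ v n, X v n = (1 : Matrix (Fin p) (Fin p) ℝ) v n + ∑ a, L a v * X a n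

theorem SolvesStructural.phiG_apply {p : ℕ} {L X : Matrix (Fin p) (Fin p) ℝ}
    (h : SolvesStructural L X) (a b : Fin p) :
    phiG (diagonal fun _ => 1) L a b = X a ⬝ᵥ X b := by
  have hX : X = 1 + Lᵀ * X := by
    ext v n
    rw [h v n]
    simp [mul_apply]
  have hinv : (1 - L)⁻¹ = Xᵀ := by
    apply inv_eq_left_inv
    have := congrArg transpose hX
    simp only [transpose_add, transpose_mul, transpose_transpose, transpose_one] at this
    rw [mul_sub, mul_one, sub_eq_iff_eq_add]
    exact this
  rw [phiG, hinv, diagonal_one, transpose_transpose, mul_one]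
  rfl

/-- A choice of coefficients for the edge `ij` together with a path from `j` to `t` outside `A`,
with all coefficients equal to one. -/
structure PathModel {p : ℕ} (E : Finset (Fin p × Fin p)) (i j : Fin p) (A : Finset (Fin p))
    (t : Fin p) (L X : Matrix (Fin p) (Fin p) ℝ) : Prop where
  support : ∀ a b, L a b ≠ 0 → (a, b) ∈ E ∧ ReflTransGen (fun a b => (a, b) ∈ E) b t
  solves : SolvesStructural L X
  coeff : L i j = 1
  source : X i = Pi.single i 1
  target : X j = Pi.single i 1 + Pi.single j 1
  last_source : X t i = 1
  last_target : X t j = 1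
  last_notMem : t ∉ A
  isolated : ∀ a ∈ A, a ≠ i → X a = Pi.single a 1 ∧ ∀ b, b ≠ a → X b a = 0

theorem PathModel.base {p : ℕ} {E : Finset (Fin p × Fin p)} {i j : Fin p} {A : Finset (Fin p)}
    (hij : (i, j) ∈ E) (hne : i ≠ j) (hj : j ∉ A) :
    PathModel E i j A j (single i j 1) (1 + single j i 1) where
  support a b hab := by
    by_cases h : i = a ∧ j = b
    · obtain ⟨rfl, rfl⟩ := h
      exact ⟨hij, .refl⟩
    · simp [h] at hab
  solves v n := by
    rw [← transpose_apply (1 + single j i 1)]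
    have : ∀ a, single i j (1 : ℝ) a v * (1 + single j i 1 : Matrix (Fin p) (Fin p) ℝ) a n =
        if a = i then single i j (1 : ℝ) i v * (1 : Matrix (Fin p) (Fin p) ℝ) i n else 0 := by
      intro a
      by_cases ha : a = i
      · subst ha
        simp [single_apply, hne.symm]
      · simp [single_apply, ha, Ne.symm ha]
    simp only [this, Finset.sum_ite_eq', Finset.mem_univ, if_true]
    simp [single_apply, one_apply]
    grind
  coeff := by simp
  source := by
    ext n
    simp [one_apply, Pi.single_apply, hne.symm, eq_comm]
  target := by
    ext n
    simp [single_apply, one_apply, Pi.single_apply, eq_comm, add_comm]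
  last_source := by simp [one_apply, hne.symm]
  last_target := by simp [hne]
  last_notMem := hj
  isolated a ha hai := by
    have haj : a ≠ j := fun h => hj (h ▸ ha)
    refine ⟨?_, fun b hb => ?_⟩
    · ext n
      simp [one_apply, Pi.single_apply, haj.symm, eq_comm]
    · simp [one_apply, hb, hai.symm]

theorem PathModel.step {p : ℕ} {E : Finset (Fin p × Fin p)} (hE : IsAcyclic E) {i j : Fin p}
    {A : Finset (Fin p)} {t k : Fin p} {L X : Matrix (Fin p) (Fin p) ℝ} (hij : (i, j) ∈ E)
    (hjt : ReflTransGen (fun a b => (a, b) ∈ E) j t) (htk : (t, k) ∈ E)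
    (h : PathModel E i j A t L X) :
    PathModel E i j (A.erase k) k (L + single t k 1) (X.updateRow k (X t + Pi.single k 1)) := by
  have hcyc : ∀ b, ReflTransGen (fun a b => (a, b) ∈ E) b t → b ≠ k := by
    rintro b hb rfl
    exact hE b (.tail' hb htk)
  have hjk : j ≠ k := hcyc j hjt
  have hik : i ≠ k := hcyc i (.head hij hjt)
  have htk' : t ≠ k := hcyc t .refl
  have hrow : ∀ b, L k b = 0 := by
    intro b
    by_contra hb
    obtain ⟨h1, h2⟩ := h.support k b hb
    exact hcyc k (.head h1 h2) rfl
  have hcol : ∀ a, L a k = 0 := by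
    intro a
    by_contra ha
    exact hcyc k (h.support a k ha).2 rfl
  refine ⟨?_, ?_, ?_, ?_, ?_, ?_, ?_, ?_, ?_⟩
  · intro a b hab
    by_cases hL : L a b = 0
    · by_cases hs : t = a ∧ k = b
      · obtain ⟨rfl, rfl⟩ := hs
        exact ⟨htk, .refl⟩
      · simp [hs, hL] at hab
    · obtain ⟨h1, h2⟩ := h.support a b hL
      exact ⟨h1, h2.tail htk⟩
  · intro v n
    by_cases hv : v = k
    · subst hv
      have : ∀ a, (L + single t v 1 : Matrix (Fin p) (Fin p) ℝ) a v *
          (X.updateRow v (X t + Pi.single v 1)) a n = if a = t then X t n else 0 := by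
        intro a
        by_cases ha : a = t
        · subst ha
          simp [hcol, updateRow_apply, htk']
        · simp [hcol, ha, Ne.symm ha]
      simp only [this, Finset.sum_ite_eq', Finset.mem_univ, if_true]
      simp [one_apply, Pi.single_apply, eq_comm, add_comm]
    · rw [updateRow_ne hv, h.solves v n]
      congr 1
      refine Finset.sum_congr rfl fun a _ => ?_
      by_cases ha : a = k
      · subst ha
        simp [hrow, htk']
      · simp [updateRow_apply, ha, Ne.symm hv]
  · simp [h.coeff, hjk.symm]
  · rw [updateRow_ne hik, h.source]
  · rw [updateRow_ne hjk, h.target]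
  · simp [h.last_source, hik]
  · simp [h.last_target, hjk]
  · simp
  · intro a ha hai
    obtain ⟨hak, haA⟩ := Finset.mem_erase.1 ha
    obtain ⟨h1, h2⟩ := h.isolated a haA hai
    refine ⟨by rw [updateRow_ne hak, h1], fun b hb => ?_⟩
    by_cases hbk : b = k
    · subst hbk
      have : t ≠ a := fun hta => h.last_notMem (hta ▸ haA)
      simp [h2 t this, hak]
    · rw [updateRow_ne hbk, h2 b hb]

theorem exists_pathModel {p : ℕ} {E : Finset (Fin p × Fin p)} (hE : IsAcyclic E) {i j : Fin p}
    {A : Finset (Fin p)} (hij : (i, j) ∈ E) (hj : j ∉ A) {t : Fin p}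
    (hjt : ReflTransGen (fun a b => (a, b) ∈ E ∧ b ∉ A) j t) :
    ∃ L X, PathModel E i j A t L X := by
  induction hjt with
  | refl => exact ⟨_, _, .base hij (fun h => hE i (.single (by rwa [← h] at hij))) hj⟩
  | @tail t k hjt htk ih =>
    obtain ⟨L, X, h⟩ := ih
    have := h.step hE hij (hjt.lift id fun _ _ hab => hab.1) htk.1
    rw [Finset.erase_eq_of_notMem htk.2] at this
    exact ⟨_, _, this⟩

/-- A path that ends in `A` has a first vertex in `A`. -/
theorem exists_first_mem_of_transGen {α : Type*} {r : α → α → Prop} {A : Set α} {j k : α}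
    (h : TransGen r j k) (hk : k ∈ A) :
    ∃ t k', ReflTransGen (fun a b => r a b ∧ b ∉ A) j t ∧ r t k' ∧ k' ∈ A := by
  by_contra! hcon
  have : ∀ v, ReflTransGen r j v → ReflTransGen (fun a b => r a b ∧ b ∉ A) j v := by
    intro v hv
    induction hv with
    | refl => exact .refl
    | tail _ hbc ih => exact ih.tail ⟨hbc, hcon _ _ ih hbc⟩
  obtain ⟨t, ht, htk⟩ := TransGen.tail'_iff.1 h
  exact hcon t k (this t ht) htk hk

/-- An identifying set contains the source of the edge, because without it the conditional
covariance scales with the noise variances. -/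
theorem source_mem_of_identifying {p : ℕ} (E : Finset (Fin p × Fin p))
    (i j : Fin p) (hij : (i, j) ∈ E) (A : Finset (Fin p))
    (hA : ∀ (ω : Fin p → ℝ) (L : Matrix (Fin p) (Fin p) ℝ),
        (∀ v, 0 < ω v) → (∀ a b, (a, b) ∉ E → L a b = 0) →
        cminor (phiG (Matrix.diagonal ω) L) i j (A.erase i) /
          pminor (phiG (Matrix.diagonal ω) L) A = L i j) :
    i ∈ A := by
  by_contra hi
  have hL : ∀ a b, (a, b) ∉ E → single i j (1 : ℝ) a b = 0 := by
    intro a b hab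
    rw [single_apply, if_neg]
    rintro ⟨rfl, rfl⟩
    exact hab hij
  have h1 := hA (fun _ => 1) _ (fun _ => one_pos) hL
  have h2 := hA (fun _ => 2) _ (fun _ => two_pos) hL
  have hscale : phiG (diagonal fun _ => 2) (single i j (1 : ℝ)) =
      (2 : ℝ) • phiG (diagonal fun _ => 1) (single i j (1 : ℝ)) := by
    have : (diagonal fun _ => 2 : Matrix (Fin p) (Fin p) ℝ) = (2 : ℝ) • diagonal fun _ => 1 := by
      rw [← diagonal_smul]
      congr 1
      funext
      simp
    rw [phiG, this, Matrix.mul_smul, Matrix.smul_mul, phiG]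
  rw [hscale] at h2
  generalize phiG (diagonal fun _ => 1) (single i j (1 : ℝ)) = S at h1 h2
  rw [Finset.erase_eq_of_notMem hi] at h1 h2
  have hc : cminor ((2 : ℝ) • S) i j A = 2 ^ (1 + A.card) * cminor S i j A := by
    simp only [cminor, submatrix_smul, Pi.smul_apply]
    rw [det_smul]
    simp
  have hp : pminor ((2 : ℝ) • S) A = 2 ^ A.card * pminor S A := by
    simp only [pminor, submatrix_smul, Pi.smul_apply]
    rw [det_smul]
    simp
  rw [hc, hp, pow_add, pow_one, mul_comm (2 : ℝ), mul_assoc,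
    mul_div_mul_left _ _ (by positivity), mul_div_assoc, h1] at h2
  norm_num at h2

/-- Necessary condition for edge-identifying sets.
Let `G = (V,E)` be a DAG and `ij ∈ E`.  If `A ⊆ V` is identifying for the edge `ij`,
i.e. `λ_{ij|A}(φ_G(Ω,Λ)) = λ_{ij}` for every `Ω = diag(ω)` with positive diagonal and
every `Λ ∈ ℝ^E`, then `i ∈ A` and `A ∩ de̅_G(j) = ∅`. -/
theorem edge_identifying_necessary {p : ℕ} (E : Finset (Fin p × Fin p)) (hE : IsAcyclic E)
    (i j : Fin p) (hij : (i, j) ∈ E) (A : Finset (Fin p))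
    (hA : ∀ (ω : Fin p → ℝ) (L : Matrix (Fin p) (Fin p) ℝ),
        (∀ v, 0 < ω v) → (∀ a b, (a, b) ∉ E → L a b = 0) →
        cminor (phiG (Matrix.diagonal ω) L) i j (A.erase i) /
          pminor (phiG (Matrix.diagonal ω) L) A = L i j) :
    i ∈ A ∧ ∀ k ∈ A, ¬ InDescClosure E j k := by
  have hi : i ∈ A := source_mem_of_identifying E i j hij A hA
  have hne : i ≠ j := fun h => hE i (.single (by rwa [← h] at hij))
  have hreg : ∀ (L X : Matrix (Fin p) (Fin p) ℝ) (c : Fin p → ℝ), SolvesStructural L X →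
      (∀ a b, (a, b) ∉ E → L a b = 0) → L i j = 1 →
      (∀ a ∈ A, X a ⬝ᵥ X j = ∑ b ∈ A, X a ⬝ᵥ X b * c b) → c i = 1 := by
    intro L X c hX hL hLij hc
    have h := hA (fun _ => 1) L (fun _ => one_pos) hL
    rw [cminor_erase_eq_mul_pminor _ j hi c (by simpa only [hX.phiG_apply] using hc), hLij] at h
    rwa [mul_div_cancel_right₀] at h
    rintro h0
    rw [h0, div_zero] at h
    exact zero_ne_one h
  have hj : j ∉ A := by
    intro hj
    have hm := PathModel.base (A := ∅) hij hne (by simp)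
    have := hreg _ _ (Pi.single j 1) hm.solves
      (fun a b hab => by_contra fun h0 => hab (hm.support a b h0).1) hm.coeff
      (fun a _ => by simp [Pi.single_apply, hj])
    simp [hne] at this
  refine ⟨hi, fun k₀ hk₀ hdesc => ?_⟩
  rcases hdesc with rfl | hdesc
  · exact hj hk₀
  obtain ⟨t, k, hjt, htk, hk⟩ := exists_first_mem_of_transGen (A := (A : Set (Fin p))) hdesc hk₀
  obtain ⟨L₀, X₀, hm₀⟩ := exists_pathModel hE hij hj hjt
  have hjt' : ReflTransGen (fun a b => (a, b) ∈ E) j t := hjt.lift id fun _ _ hab => hab.1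
  have hm := hm₀.step hE hij hjt' htk
  have hki : k ≠ i := by
    rintro rfl
    exact hE k (.tail' (.head hij hjt') htk)
  generalize L₀ + single t k 1 = L at hm
  generalize X₀.updateRow k (X₀ t + Pi.single k 1) = X at hm
  set q := X k ⬝ᵥ X k with hq
  have hq1 : 1 < q := by
    have : ∑ n ∈ {i, j}, X k n * X k n ≤ q :=
      Finset.sum_le_sum_of_subset_of_nonneg (Finset.subset_univ _)
        fun n _ _ => mul_self_nonneg _
    rw [Finset.sum_pair hne, hm.last_source, hm.last_target] at this
    linarith
  have hq0 : q - 1 ≠ 0 := by linarith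
  have := hreg L X (Pi.single i (1 - 1 / (q - 1)) + Pi.single k (1 / (q - 1))) hm.solves
    (fun a b hab => by_contra fun h0 => hab (hm.support a b h0).1) hm.coeff
    (fun a ha => by
      have hsum : ∑ b ∈ A, X a ⬝ᵥ X b *
          (Pi.single i (1 - 1 / (q - 1)) + Pi.single k (1 / (q - 1)) : Fin p → ℝ) b =
          X a ⬝ᵥ X i * (1 - 1 / (q - 1)) + X a ⬝ᵥ X k * (1 / (q - 1)) := by
        simp only [Pi.add_apply, mul_add, Finset.sum_add_distrib]
        simp [Pi.single_apply, hi, Finset.mem_coe.1 hk]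
      rw [hsum]
      by_cases hai : a = i
      · subst hai
        simp [hm.source, hm.target, hm.last_source, hne]
      by_cases hak : a = k
      · subst hak
        rw [← hq]
        simp only [hm.source, hm.target, dotProduct_add, dotProduct_single, hm.last_source,
          hm.last_target]
        field_simp
        ring
      · obtain ⟨h1, h2⟩ := hm.isolated a (Finset.mem_erase.2 ⟨hak, ha⟩) hai
        simp [h1, h2 i (Ne.symm hai), h2 k (Ne.symm hak), h2 j (fun h => hj (h ▸ ha))])
  simp [hki.symm, hq0] at this
end

section
/- Let (G,c) and (H,d) be colored DAGs on the same vertex set V with M(G,c) = M(H,d). Suppose that either both c and d are vertex-colorings (i.e., each assigns every edge its own singleton color class) or both c and d are edge-colorings (i.e., each assigns every vertex its own singleton color class). Then G and H have the same skeleton and the same v-structures. -/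
open Matrix

/-- The colored Gaussian DAG model `M(G,c)`. -/
noncomputable def coloredModel {p : ℕ} (E : Finset (Fin p × Fin p))
    (cV : Fin p → ℕ) (cE : Fin p × Fin p → ℕ) : Set (Matrix (Fin p) (Fin p) ℝ) :=
  {S | ∃ (ω : Fin p → ℝ) (L : Matrix (Fin p) (Fin p) ℝ),
    (∀ v, 0 < ω v) ∧ (∀ a b, (a, b) ∉ E → L a b = 0) ∧
    (∀ a b, cV a = cV b → ω a = ω b) ∧
    (∀ e ∈ E, ∀ e' ∈ E, cE e = cE e' → L e.1 e.2 = L e'.1 e'.2) ∧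
    S = phiG (Matrix.diagonal ω) L}

/-- `i` and `j` are adjacent in the DAG with edge set `E`. -/
def Adjacent {p : ℕ} (E : Finset (Fin p × Fin p)) (i j : Fin p) : Prop :=
  (i, j) ∈ E ∨ (j, i) ∈ E

open Filter Topology

/-- `S a k` is, for `a = i` and for `a ∈ K`, the same linear combination of the entries `S a l`,
`l ∈ K`. For a positive definite `S` this is the vanishing of the conditional covariance of `i`
and `k` given `K`. -/
def RegressesOn {p : ℕ} (S : Matrix (Fin p) (Fin p) ℝ) (i k : Fin p) (K : Finset (Fin p)) : Prop :=
  ∃ v : Fin p → ℝ, ∀ a, a = i ∨ a ∈ K → S a k = ∑ l ∈ K, S a l * v l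

theorem IsAcyclic.wellFounded {p : ℕ} {E : Finset (Fin p × Fin p)} (hE : IsAcyclic E) :
    WellFounded (fun b a : Fin p => (a, b) ∈ E) := by
  have : Std.Irrefl (Relation.TransGen fun b a : Fin p => (a, b) ∈ E) :=
    ⟨fun a h => hE a (Relation.transGen_swap.mp h)⟩
  exact Subrelation.wf (fun h => Relation.TransGen.single h)
    (Finite.wellFounded_of_trans_of_irrefl (Relation.TransGen fun b a : Fin p => (a, b) ∈ E))

theorem IsAcyclic.isUnit_det {p : ℕ} {E : Finset (Fin p × Fin p)} (hE : IsAcyclic E)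
    {L : Matrix (Fin p) (Fin p) ℝ} (hL : ∀ a b, (a, b) ∉ E → L a b = 0) :
    IsUnit (1 - L).det := by
  rw [← Matrix.isUnit_iff_isUnit_det, ← Matrix.mulVec_injective_iff_isUnit]
  suffices h : ∀ v, (1 - L) *ᵥ v = 0 → v = 0 from fun v w hvw =>
    sub_eq_zero.mp (h _ (by rw [Matrix.mulVec_sub, hvw, sub_self]))
  intro v hv
  rw [Matrix.sub_mulVec, Matrix.one_mulVec, sub_eq_zero] at hv
  funext a
  induction a using hE.wellFounded.induction with
  | _ a ih =>
    rw [hv]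
    simp only [Matrix.mulVec, dotProduct, Pi.zero_apply]
    refine Finset.sum_eq_zero fun b _ => ?_
    by_cases hab : (a, b) ∈ E
    · simp [ih b hab]
    · simp [hL a b hab]

theorem IsAcyclic.inv_apply_eq_zero {p : ℕ} {E : Finset (Fin p × Fin p)} (hE : IsAcyclic E)
    {L : Matrix (Fin p) (Fin p) ℝ} (hL : ∀ a b, (a, b) ∉ E → L a b = 0) {k a : Fin p}
    (hka : ¬ InDescClosure E k a) : (1 - L)⁻¹ k a = 0 := by
  have hN : (1 - L)⁻¹ = 1 + L * (1 - L)⁻¹ := by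
    have := Matrix.mul_nonsing_inv _ (hE.isUnit_det hL)
    rwa [sub_mul, one_mul, sub_eq_iff_eq_add] at this
  induction k using hE.wellFounded.induction with
  | _ k ih =>
    simp only [InDescClosure, not_or] at hka ih
    rw [hN, Matrix.add_apply, Matrix.one_apply_ne (Ne.symm hka.1), zero_add, Matrix.mul_apply]
    refine Finset.sum_eq_zero fun b _ => ?_
    by_cases hkb : (k, b) ∈ E
    · rw [ih b hkb ⟨?_, fun h => hka.2 (Relation.TransGen.head hkb h)⟩, mul_zero]
      rintro rfl
      exact hka.2 (Relation.TransGen.single hkb)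
    · rw [hL k b hkb, zero_mul]

theorem regressesOn_parents {p : ℕ} {F : Finset (Fin p × Fin p)} (hF : IsAcyclic F)
    {dV : Fin p → ℕ} {dE : Fin p × Fin p → ℕ} {S : Matrix (Fin p) (Fin p) ℝ}
    (hS : S ∈ coloredModel F dV dE) {i k : Fin p} (hik : ¬ InDescClosure F k i) :
    RegressesOn S i k (parents F k) := by
  obtain ⟨ω, L, -, hL, -, -, rfl⟩ := hS
  have hinv := Matrix.nonsing_inv_mul _ (hF.isUnit_det hL)
  refine ⟨fun l => L l k, fun a ha => ?_⟩
  have hka : ¬ InDescClosure F k a := by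
    rcases ha with rfl | ha
    · exact hik
    · have hak : (a, k) ∈ F := by simpa [parents] using ha
      rintro (rfl | h)
      · exact hF a (Relation.TransGen.single hak)
      · exact hF k (h.tail hak)
  have hmul : phiG (Matrix.diagonal ω) L * (1 - L) = ((1 - L)⁻¹)ᵀ * Matrix.diagonal ω := by
    rw [phiG, Matrix.mul_assoc, hinv, Matrix.mul_one]
  have hent := congrFun (congrFun hmul a) k
  rw [Matrix.mul_diagonal, Matrix.transpose_apply, hF.inv_apply_eq_zero hL hka, zero_mul,
    mul_sub, mul_one, Matrix.sub_apply, sub_eq_zero, Matrix.mul_apply] at hent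
  rw [hent]
  symm
  refine Finset.sum_subset (Finset.subset_univ _) fun l _ hl => ?_
  simp [hL l k (by simpa [parents] using hl)]

/-- Second-order expansion of a regression identity along a curve of matrices that starts at a
diagonal matrix. -/
theorem regressesOn_expansion {p : ℕ} {S : ℝ → Matrix (Fin p) (Fin p) ℝ} {ω : Fin p → ℝ}
    {S₁ S₂ : Matrix (Fin p) (Fin p) ℝ} {Q : ℝ → Matrix (Fin p) (Fin p) ℝ}
    (hω : ∀ v, 0 < ω v) (hS : ∀ t, S t = Matrix.diagonal ω + t • S₁ + t ^ 2 • Q t)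
    (hQ : Tendsto Q (𝓝[≠] 0) (𝓝 S₂)) {i k : Fin p} {K : Finset (Fin p)}
    (hik : i ≠ k) (hi : i ∉ K) (hk : k ∉ K) (h : ∀ t, RegressesOn (S t) i k K) :
    S₁ i k = 0 ∧ S₂ i k = ∑ l ∈ K, S₁ i l * (S₁ l k / ω l) := by
  choose v hv using h
  have ht : Tendsto (fun t : ℝ => t) (𝓝[≠] 0) (𝓝 0) := tendsto_nhdsWithin_of_tendsto_nhds tendsto_id
  have hne : ∀ᶠ t : ℝ in 𝓝[≠] 0, t ≠ 0 := self_mem_nhdsWithin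
  have hQe : ∀ a b, Tendsto (fun t => Q t a b) (𝓝[≠] 0) (𝓝 (S₂ a b)) := fun a b =>
    tendsto_pi_nhds.mp (tendsto_pi_nhds.mp hQ a) b
  have hSlim : Tendsto S (𝓝[≠] 0) (𝓝 (Matrix.diagonal ω)) := by
    have := ((tendsto_const_nhds (x := Matrix.diagonal ω)).add (ht.smul_const S₁)).add
      ((ht.pow 2).smul hQ)
    simpa [← funext hS] using this
  have hoff : ∀ a b, a ≠ b → Tendsto (fun t => S t a b / t) (𝓝[≠] 0) (𝓝 (S₁ a b)) := by
    intro a b hab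
    have h1 : Tendsto (fun t => S₁ a b + t * Q t a b) (𝓝[≠] 0) (𝓝 (S₁ a b)) := by
      simpa using (tendsto_const_nhds (x := S₁ a b)).add (ht.mul (hQe a b))
    refine h1.congr' ?_
    filter_upwards [hne] with t ht0
    simp [hS, Matrix.diagonal_apply_ne _ hab]
    field_simp
  have hv_lim : ∀ l ∈ K, Tendsto (fun t => v t l / t) (𝓝[≠] 0) (𝓝 (S₁ l k / ω l)) := by
    let T : ℝ → Matrix K K ℝ := fun t => (S t).submatrix (↑) (↑)
    let D : Matrix K K ℝ := Matrix.diagonal fun l => ω l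
    have hT : Tendsto T (𝓝[≠] 0) (𝓝 D) := by
      refine tendsto_pi_nhds.mpr fun a => tendsto_pi_nhds.mpr fun b => ?_
      have h1 := tendsto_pi_nhds.mp (tendsto_pi_nhds.mp hSlim a) b
      have h2 : Matrix.diagonal ω (a : Fin p) b = D a b := by
        simp only [D, Matrix.diagonal_apply, Subtype.coe_inj]
      rwa [h2] at h1
    have hDdet : D.det ≠ 0 := by
      rw [Matrix.det_diagonal]
      exact Finset.prod_ne_zero_iff.mpr fun l _ => (hω l).ne'
    have hdet : Tendsto (fun t => (T t).det) (𝓝[≠] 0) (𝓝 D.det) :=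
      ((continuous_id.matrix_det).tendsto _).comp hT
    have hadj : Tendsto (fun t => (T t).adjugate) (𝓝[≠] 0) (𝓝 D.adjugate) :=
      ((continuous_id.matrix_adjugate).tendsto _).comp hT
    have hw : Tendsto (fun t => fun a : K => S t a k / t) (𝓝[≠] 0) (𝓝 fun a : K => S₁ a k) :=
      tendsto_pi_nhds.mpr fun a => hoff a k fun hak => hk (hak ▸ a.2)
    have hmv : Tendsto (fun t => (T t).adjugate *ᵥ fun a : K => S t a k / t) (𝓝[≠] 0)
        (𝓝 (D.adjugate *ᵥ fun a : K => S₁ a k)) :=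
      tendsto_pi_nhds.mpr fun a => tendsto_finsetSum _ fun b _ =>
        (tendsto_pi_nhds.mp (tendsto_pi_nhds.mp hadj a) b).mul (tendsto_pi_nhds.mp hw b)
    have hu := (hdet.inv₀ hDdet).smul hmv
    have hlim : D.det⁻¹ • (D.adjugate *ᵥ fun a : K => S₁ a k) = fun a : K => S₁ a k / ω a := by
      have h1 : (fun a : K => S₁ a k) = D *ᵥ fun a : K => S₁ a k / ω a := by
        funext a
        simp only [D, Matrix.mulVec_diagonal]
        rw [mul_div_cancel₀ _ (hω a).ne']
      conv_lhs => rw [h1]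
      rw [Matrix.mulVec_mulVec, Matrix.adjugate_mul, Matrix.smul_mulVec, Matrix.one_mulVec,
        inv_smul_smul₀ hDdet]
    have hev : (fun t => (T t).det⁻¹ • ((T t).adjugate *ᵥ fun a : K => S t a k / t)) =ᶠ[𝓝[≠] 0]
        fun t => fun a : K => v t a / t := by
      filter_upwards [hdet.eventually_ne hDdet] with t hdt
      have h1 : (fun a : K => S t a k / t) = T t *ᵥ fun a : K => v t a / t := by
        funext a
        rw [hv t a (Or.inr a.2), ← Finset.sum_coe_sort, Finset.sum_div]
        simp only [T, Matrix.mulVec, dotProduct, Matrix.submatrix_apply, mul_div_assoc]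
      rw [h1, Matrix.mulVec_mulVec, Matrix.adjugate_mul, Matrix.smul_mulVec, Matrix.one_mulVec,
        inv_smul_smul₀ hdt]
    rw [hlim] at hu
    intro l hl
    exact tendsto_pi_nhds.mp (hu.congr' hev) ⟨l, hl⟩
  have hprod : Tendsto (fun t => ∑ l ∈ K, S t i l / t * (v t l / t)) (𝓝[≠] 0)
      (𝓝 (∑ l ∈ K, S₁ i l * (S₁ l k / ω l))) :=
    tendsto_finsetSum _ fun l hl =>
      (hoff i l fun hil => hi (hil ▸ hl)).mul (hv_lim l hl)
  have hfirst : S₁ i k = 0 := by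
    refine tendsto_nhds_unique (hoff i k hik) ?_
    have h1 := ht.mul hprod
    rw [zero_mul] at h1
    refine h1.congr' ?_
    filter_upwards [hne] with t ht0
    rw [hv t i (Or.inl rfl), Finset.mul_sum, Finset.sum_div]
    refine Finset.sum_congr rfl fun l _ => ?_
    field_simp
  refine ⟨hfirst, tendsto_nhds_unique (hQe i k) (hprod.congr' ?_)⟩
  filter_upwards [hne] with t ht0
  have h1 := hv t i (Or.inl rfl)
  simp only [hS t, Matrix.add_apply, Matrix.smul_apply, Matrix.diagonal_apply_ne _ hik, hfirst,
    smul_eq_mul, mul_zero, zero_add] at h1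
  rw [← mul_left_cancel_iff_of_pos (pow_pos (abs_pos.mpr ht0) 2), sq_abs, h1, Finset.mul_sum]
  refine Finset.sum_congr rfl fun l _ => ?_
  rw [hS t]
  simp only [Matrix.add_apply, Matrix.smul_apply, smul_eq_mul]
  field_simp

/-- Second-order expansion of `phiG` at `L = 0` in the direction `B`. -/
theorem IsAcyclic.phiG_expansion {p : ℕ} {E : Finset (Fin p × Fin p)} (hE : IsAcyclic E)
    {B : Matrix (Fin p) (Fin p) ℝ} (hB : ∀ a b, (a, b) ∉ E → B a b = 0)
    (W : Matrix (Fin p) (Fin p) ℝ) :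
    ∃ Q : ℝ → Matrix (Fin p) (Fin p) ℝ,
      (∀ t : ℝ, phiG W (t • B) = W + t • (Bᵀ * W + W * B) + t ^ 2 • Q t) ∧
      Tendsto Q (𝓝[≠] 0) (𝓝 ((B * B)ᵀ * W + W * (B * B) + Bᵀ * W * B)) := by
  let N : ℝ → Matrix (Fin p) (Fin p) ℝ := fun t => (1 - t • B)⁻¹
  have hunit : ∀ t : ℝ, IsUnit (1 - t • B).det := fun t =>
    hE.isUnit_det fun a b hab => by simp [hB a b hab]
  have hN : ∀ t : ℝ, N t = 1 + t • (B * N t) := by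
    intro t
    have := Matrix.mul_nonsing_inv _ (hunit t)
    rwa [sub_mul, one_mul, Matrix.smul_mul, sub_eq_iff_eq_add] at this
  have hcont : Continuous N := by
    have : N = fun t : ℝ => (1 - t • B).det⁻¹ • (1 - t • B).adjugate := by
      funext t
      simp only [N, Matrix.inv_def, Ring.inverse_eq_inv']
    rw [this]
    have h1 : Continuous fun t : ℝ => 1 - t • B := by fun_prop
    exact (h1.matrix_det.inv₀ fun t => (hunit t).ne_zero).smul h1.matrix_adjugate
  refine ⟨fun t => (B * B * N t)ᵀ * W + W * (B * B * N t) + (B * N t)ᵀ * W * (B * N t), ?_, ?_⟩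
  · intro t
    have hphi : phiG W (t • B) = (N t)ᵀ * W * N t := rfl
    have hM : B * N t = B + t • (B * B * N t) := by
      conv_lhs => rw [hN t]
      rw [Matrix.mul_add, Matrix.mul_one, Matrix.mul_smul, Matrix.mul_assoc]
    have hl : (B * N t)ᵀ * W = Bᵀ * W + t • ((B * B * N t)ᵀ * W) := by
      conv_lhs => rw [hM]
      rw [Matrix.transpose_add, Matrix.transpose_smul, Matrix.add_mul, Matrix.smul_mul]
    have hr : W * (B * N t) = W * B + t • (W * (B * B * N t)) := by
      conv_lhs => rw [hM]
      rw [Matrix.mul_add, Matrix.mul_smul]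
    have hexp : (N t)ᵀ * W * N t = W + t • ((B * N t)ᵀ * W + W * (B * N t)) +
        t ^ 2 • ((B * N t)ᵀ * W * (B * N t)) := by
      conv_lhs => rw [hN t]
      generalize B * N t = M
      simp only [Matrix.transpose_add, Matrix.transpose_smul, Matrix.transpose_one,
        Matrix.add_mul, Matrix.mul_add, Matrix.smul_mul, Matrix.mul_smul, Matrix.one_mul,
        Matrix.mul_one]
      module
    beta_reduce
    rw [hphi, hexp]
    generalize (B * N t)ᵀ * W * (B * N t) = P
    rw [hl, hr]
    module
  · have h0 : N 0 = 1 := by simp [N]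
    have hc : Continuous fun t => (B * B * N t)ᵀ * W + W * (B * B * N t) +
        (B * N t)ᵀ * W * (B * N t) := by fun_prop
    have := hc.tendsto 0
    simp only [h0, Matrix.mul_one] at this
    exact this.mono_left nhdsWithin_le_nhds

/-- The polynomial identities forced on a colored model by a regression identity. -/
theorem coloredModel_identities {p : ℕ} {E : Finset (Fin p × Fin p)} (hE : IsAcyclic E)
    {cV : Fin p → ℕ} {cE : Fin p × Fin p → ℕ} {ω : Fin p → ℝ} {B : Matrix (Fin p) (Fin p) ℝ}
    (hω : ∀ v, 0 < ω v) (hB : ∀ a b, (a, b) ∉ E → B a b = 0)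
    (hcV : ∀ a b, cV a = cV b → ω a = ω b)
    (hcE : ∀ e ∈ E, ∀ e' ∈ E, cE e = cE e' → B e.1 e.2 = B e'.1 e'.2)
    {i k : Fin p} {K : Finset (Fin p)} (hik : i ≠ k) (hi : i ∉ K) (hk : k ∉ K)
    (h : ∀ S ∈ coloredModel E cV cE, RegressesOn S i k K) :
    B k i * ω k + ω i * B i k = 0 ∧
      ∑ l ∈ Kᶜ, (ω k * (B k l * B l i) + ω i * (B i l * B l k) + ω l * (B l i * B l k)) =
        ∑ l ∈ K, ω i * ω k * (B i l * B k l) / ω l := by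
  obtain ⟨Q, hQ, hQlim⟩ := hE.phiG_expansion hB (Matrix.diagonal ω)
  have hmem : ∀ t : ℝ, phiG (Matrix.diagonal ω) (t • B) ∈ coloredModel E cV cE := fun t =>
    ⟨ω, t • B, hω, fun a b hab => by simp [hB a b hab], hcV,
      fun e he e' he' hee => by simp [hcE e he e' he' hee], rfl⟩
  obtain ⟨h1, h2⟩ := regressesOn_expansion hω hQ hQlim hik hi hk fun t => h _ (hmem t)
  have hs : ∀ a b, (Bᵀ * Matrix.diagonal ω + Matrix.diagonal ω * B) a b =
      B b a * ω b + ω a * B a b := fun a b => by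
    rw [Matrix.add_apply, Matrix.mul_diagonal, Matrix.diagonal_mul, Matrix.transpose_apply]
  rw [hs] at h1
  refine ⟨h1, ?_⟩
  have hs2 : ((B * B)ᵀ * Matrix.diagonal ω + Matrix.diagonal ω * (B * B) +
      Bᵀ * Matrix.diagonal ω * B) i k =
      ∑ l, (ω k * (B k l * B l i) + ω i * (B i l * B l k) + ω l * (B l i * B l k)) := by
    rw [Matrix.add_apply, Matrix.add_apply, Matrix.mul_diagonal, Matrix.diagonal_mul,
      Matrix.transpose_apply, Matrix.mul_apply, Matrix.mul_apply, Matrix.mul_apply,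
      Finset.sum_mul, Finset.mul_sum, ← Finset.sum_add_distrib, ← Finset.sum_add_distrib]
    refine Finset.sum_congr rfl fun l _ => ?_
    rw [Matrix.mul_diagonal, Matrix.transpose_apply]
    ring
  rw [hs2, ← Finset.sum_compl_add_sum K, ← eq_sub_iff_add_eq, ← Finset.sum_sub_distrib] at h2
  rw [h2]
  refine Finset.sum_congr rfl fun l _ => ?_
  have := (hω l).ne'
  rw [hs, hs]
  field_simp
  ring

theorem exists_separator {p : ℕ} {F : Finset (Fin p × Fin p)} (hF : IsAcyclic F)
    (dV : Fin p → ℕ) (dE : Fin p × Fin p → ℕ) {i k : Fin p} (hne : i ≠ k)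
    (hik : ¬ Adjacent F i k) :
    ∃ K : Finset (Fin p), i ∉ K ∧ k ∉ K ∧
      ((∀ S ∈ coloredModel F dV dE, RegressesOn S i k K) ∨
        (∀ S ∈ coloredModel F dV dE, RegressesOn S k i K)) ∧
      ∀ j, Adjacent F i j → Adjacent F k j → ((i, j) ∈ F ∧ (k, j) ∈ F) ∨ j ∈ K := by
  wlog hki : ¬ Relation.TransGen (fun a b => (a, b) ∈ F) k i generalizing i k
  · have hki' : ¬ Relation.TransGen (fun a b => (a, b) ∈ F) i k := fun h =>
      hF i (h.trans (not_not.mp hki))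
    obtain ⟨K, hk, hi, hS, hj⟩ := this hne.symm (fun h => hik h.symm) hki'
    exact ⟨K, hi, hk, hS.symm, fun j hij hkj => (hj j hkj hij).imp_left And.symm⟩
  refine ⟨parents F k, fun h => hik (Or.inl (by simpa [parents] using h)),
    fun h => hF k (.single (by simpa [parents] using h)),
    Or.inl fun S hS => regressesOn_parents hF hS (not_or.mpr ⟨hne, hki⟩), fun j hij hkj => ?_⟩
  rcases hkj with hkj | hjk
  · rcases hij with hij | hji
    · exact Or.inl ⟨hij, hkj⟩
    · exact absurd (.tail (.single hkj) hji) hki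
  · exact Or.inr (by simpa [parents] using hjk)

theorem Adjacent.of_coloredModel_subset {p : ℕ} {E F : Finset (Fin p × Fin p)}
    (hE : IsAcyclic E) (hF : IsAcyclic F) {cV dV : Fin p → ℕ} {cE dE : Fin p × Fin p → ℕ}
    (hsub : coloredModel E cV cE ⊆ coloredModel F dV dE) {i k : Fin p}
    (hik : Adjacent E i k) : Adjacent F i k := by
  by_contra hFik
  have hne : i ≠ k := by
    rintro rfl
    exact hE i (.single (hik.elim id id))
  obtain ⟨K, hi, hk, hS, -⟩ := exists_separator hF dV dE hne hFik
  let B : Matrix (Fin p) (Fin p) ℝ := fun a b => if (a, b) ∈ E then 1 else 0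
  have hnonneg : ∀ a b, 0 ≤ B a b := fun a b => by
    simp only [B]
    split_ifs <;> norm_num
  have hsum : B k i + B i k = 0 := by
    have key : ∀ {a b : Fin p}, a ≠ b → a ∉ K → b ∉ K →
        (∀ S ∈ coloredModel F dV dE, RegressesOn S a b K) → B b a + B a b = 0 := by
      intro a b hab ha hb hreg
      have := (coloredModel_identities hE (ω := fun _ => 1) (B := B) (cV := cV) (cE := cE)
        (fun _ => one_pos) (fun a b h => by simp [B, h]) (fun _ _ _ => rfl)
        (fun e he e' he' _ => by simp [B, he, he']) hab ha hb fun S hS => hreg S (hsub hS)).1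
      simpa using this
    rcases hS with hS | hS
    · exact key hne hi hk hS
    · rw [add_comm]
      exact key hne.symm hk hi hS
  obtain ⟨h1, h2⟩ := (add_eq_zero_iff_of_nonneg (hnonneg k i) (hnonneg i k)).mp hsum
  rcases hik with h | h
  · simp [B, h] at h2
  · simp [B, h] at h1

/-- A collider `i → j ← k` prevents a set that contains `j` from
separating `i` and `k`, provided vertices or edges are uncolored. -/
theorem exists_not_regressesOn_of_collider {p : ℕ} {E : Finset (Fin p × Fin p)}
    (hE : IsAcyclic E) {cV : Fin p → ℕ} {cE : Fin p × Fin p → ℕ}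
    (hc : Set.InjOn cE (E : Set (Fin p × Fin p)) ∨ Function.Injective cV)
    {i j k : Fin p} {K : Finset (Fin p)} (hne : i ≠ k) (hij : (i, j) ∈ E) (hkj : (k, j) ∈ E)
    (hi : i ∉ K) (hk : k ∉ K) (hj : j ∈ K) :
    ∃ S ∈ coloredModel E cV cE, ¬ RegressesOn S i k K := by
  by_contra! hreg
  have hji : j ≠ i := fun h => hi (h ▸ hj)
  have hjk : j ≠ k := fun h => hk (h ▸ hj)
  rcases hc with hc | hc
  · let B : Matrix (Fin p) (Fin p) ℝ := fun a b => if b = j ∧ (a = i ∨ a = k) then 1 else 0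
    have h := (coloredModel_identities hE (ω := fun _ => 1) (B := B)
      (fun _ => one_pos) (fun a b hab => if_neg (by rintro ⟨rfl, rfl | rfl⟩ <;> contradiction))
      (fun _ _ _ => rfl) (fun e he e' he' hee => by rw [hc he he' hee]) hne hi hk hreg).2
    have hBi : ∀ l, B l i = 0 := fun l => if_neg fun h => hji h.1.symm
    have hBk : ∀ l, B l k = 0 := fun l => if_neg fun h => hjk h.1.symm
    rw [Finset.sum_eq_zero fun l _ => by simp [hBi, hBk]] at h
    have hpos : 0 < ∑ l ∈ K, (1 : ℝ) * 1 * (B i l * B k l) / 1 := by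
      refine Finset.sum_pos' (fun l _ => ?_) ⟨j, hj, by simp [B]⟩
      by_cases hl : l = j <;> simp [B, hl]
    exact hpos.ne h
  · let B : Matrix (Fin p) (Fin p) ℝ := fun a b => if (a, b) ∈ E then 1 else 0
    have hB0 : ∀ a b, 0 ≤ B a b := fun a b => by
      simp only [B]
      split_ifs <;> norm_num
    have hB1 : ∀ a b, B a b ≤ 1 := fun a b => by
      simp only [B]
      split_ifs <;> norm_num
    let ω : Fin p → ℝ := fun v => if v = j then (3 * p + 1 : ℝ)⁻¹ else 1
    have hω : ∀ v, 0 < ω v := fun v => by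
      simp only [ω]
      split_ifs <;> positivity
    have hω1 : ∀ v, v ≠ j → ω v = 1 := fun v hv => if_neg hv
    have h := (coloredModel_identities hE (B := B) hω (fun a b hab => if_neg hab)
      (fun a b hab => by rw [hc hab]) (fun e he e' he' _ => by simp [B, he, he'])
      hne hi hk hreg).2
    rw [hω1 i hji.symm, hω1 k hjk.symm] at h
    have hle : ∑ l ∈ Kᶜ, (1 * (B k l * B l i) + 1 * (B i l * B l k) + ω l * (B l i * B l k)) ≤
        3 * p := by
      calc _ ≤ ∑ l ∈ Kᶜ, (3 : ℝ) := by
            refine Finset.sum_le_sum fun l hl => ?_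
            rw [hω1 l fun hlj => Finset.mem_compl.mp hl (hlj ▸ hj)]
            linarith [mul_le_one₀ (hB1 k l) (hB0 l i) (hB1 l i),
              mul_le_one₀ (hB1 i l) (hB0 l k) (hB1 l k),
              mul_le_one₀ (hB1 l i) (hB0 l k) (hB1 l k)]
        _ = 3 * (Kᶜ.card : ℝ) := by rw [Finset.sum_const, nsmul_eq_mul, mul_comm]
        _ ≤ 3 * p := by
            have := Finset.card_le_univ Kᶜ
            rw [Fintype.card_fin] at this
            gcongr
    have hge : (3 * p + 1 : ℝ) ≤ ∑ l ∈ K, 1 * 1 * (B i l * B k l) / ω l := by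
      have h1 := Finset.single_le_sum (s := K) (f := fun l => 1 * 1 * (B i l * B k l) / ω l)
        (fun l _ => div_nonneg (by simpa using mul_nonneg (hB0 i l) (hB0 k l)) (hω l).le) hj
      simpa [B, ω, hij, hkj] using h1
    linarith

theorem collider_of_coloredModel_eq {p : ℕ} {E F : Finset (Fin p × Fin p)}
    (hE : IsAcyclic E) (hF : IsAcyclic F) {cV dV : Fin p → ℕ} {cE dE : Fin p × Fin p → ℕ}
    (hmodels : coloredModel E cV cE = coloredModel F dV dE)
    (hc : Set.InjOn cE (E : Set (Fin p × Fin p)) ∨ Function.Injective cV) {i k j : Fin p}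
    (h : i ≠ k ∧ (i, j) ∈ E ∧ (k, j) ∈ E ∧ ¬ Adjacent E i k) :
    i ≠ k ∧ (i, j) ∈ F ∧ (k, j) ∈ F ∧ ¬ Adjacent F i k := by
  obtain ⟨hne, hij, hkj, hik⟩ := h
  have hFik : ¬ Adjacent F i k := fun h => hik (h.of_coloredModel_subset hF hE hmodels.ge)
  obtain ⟨K, hi, hk, hS, hsep⟩ := exists_separator hF dV dE hne hFik
  rcases hsep j (Adjacent.of_coloredModel_subset hE hF hmodels.le (Or.inl hij))
    (Adjacent.of_coloredModel_subset hE hF hmodels.le (Or.inl hkj)) with ⟨h1, h2⟩ | hj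
  · exact ⟨hne, h1, h2, hFik⟩
  · rw [← hmodels] at hS
    rcases hS with hS | hS
    · obtain ⟨S, hmem, hnot⟩ :=
        exists_not_regressesOn_of_collider hE hc hne hij hkj hi hk hj
      exact absurd (hS S hmem) hnot
    · obtain ⟨S, hmem, hnot⟩ := exists_not_regressesOn_of_collider hE hc hne.symm hkj hij
        hk hi hj
      exact absurd (hS S hmem) hnot

/-- Model equivalence implies Markov equivalence.
Let `(G,c)` and `(H,d)` be colored DAGs on the same vertex set with
`M(G,c) = M(H,d)`.  If both colorings are vertex-colorings (each edge in its own
singleton color class) or both are edge-colorings (each vertex in its own singleton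
color class), then `G` and `H` have the same skeleton and the same v-structures. -/
theorem model_equiv_markov_equiv {p : ℕ}
    (E F : Finset (Fin p × Fin p)) (hE : IsAcyclic E) (hF : IsAcyclic F)
    (cV dV : Fin p → ℕ) (cE dE : Fin p × Fin p → ℕ)
    (hmodels : coloredModel E cV cE = coloredModel F dV dE)
    (hcolorings :
      (Set.InjOn cE (E : Set (Fin p × Fin p)) ∧ Set.InjOn dE (F : Set (Fin p × Fin p))) ∨
      (Function.Injective cV ∧ Function.Injective dV)) :
    (∀ i j : Fin p, Adjacent E i j ↔ Adjacent F i j) ∧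
    (∀ i k j : Fin p,
      (i ≠ k ∧ (i, j) ∈ E ∧ (k, j) ∈ E ∧ ¬ Adjacent E i k) ↔
      (i ≠ k ∧ (i, j) ∈ F ∧ (k, j) ∈ F ∧ ¬ Adjacent F i k)) := by
  refine ⟨fun i j => ⟨fun h => h.of_coloredModel_subset hE hF hmodels.le,
    fun h => h.of_coloredModel_subset hF hE hmodels.ge⟩, fun i k j =>
    ⟨collider_of_coloredModel_eq hE hF hmodels (hcolorings.imp And.left And.left),
      collider_of_coloredModel_eq hF hE hmodels.symm (hcolorings.imp And.right And.right)⟩⟩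
end
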